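/- Let Δ ≥ 3 be an integer. There exists a sequence of instances (𝒯_n, w_n), where each 𝒯_n is a finite tree of maximum degree at most Δ and w_n a weight function with w_n(𝒯_n) = 1, such that lim_{n→∞} OPT(𝒯_n, w_n) = ∞ and for every n, every centroid tree C_n of (𝒯_n, w_n) satisfies cost_{w_n}(C_n) ≥ (2 − 4/2^Δ)·OPT(𝒯_n, w_n) − 1. -/

import Mathlib

open Filter Topology

universe u

variable {V : Type u}

/-- Rooted trees with vertices labelled by elements of `V`. -/
inductive RTree (V : Type u) : Type u where
  | node : V → List (RTree V) → RTree V

namespace RTree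

/-- The root of a rooted tree. -/
def root : RTree V → V
  | node r _ => r

/-- The subtrees rooted at the children of the root. -/
def children : RTree V → List (RTree V)
  | node _ ts => ts

/-- The list of pairs `(v, path from the root to v)` over all vertices `v` of the tree. -/
def pathsFrom : RTree V → List (V × List V)
  | node r ts =>
      (r, [r]) ::
        (ts.attach.map fun t => (t.1.pathsFrom.map fun p => (p.1, r :: p.2))).flatten
  decreasing_by
    simp only [RTree.node.sizeOf_spec]
    have := List.sizeOf_lt_of_mem t.2
    omega

/-- The vertex set of a rooted tree. -/
def vertSet (T : RTree V) : Set V := {v | ∃ p ∈ T.pathsFrom, p.1 = v}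

/-- `Path_T(v)`: the set of vertices on the path in `T` from the root to `v`
(including both endpoints). -/
def pathSet (T : RTree V) (v : V) : Set V := {x | ∃ p ∈ T.pathsFrom, p.1 = v ∧ x ∈ p.2}

/-- The depth of a vertex `v` in `T`; the root has depth 1. -/
noncomputable def depth (T : RTree V) (v : V) : ℕ := (T.pathSet v).ncard

/-- All subtrees of a rooted tree (including the tree itself). -/
def allSubtrees : RTree V → List (RTree V)
  | node r ts => node r ts :: (ts.attach.map fun t => t.1.allSubtrees).flatten
  decreasing_by
    simp only [RTree.node.sizeOf_spec]
    have := List.sizeOf_lt_of_mem t.2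
    omega

/-- Two rooted trees are equivalent (represent the same search tree) if they have
the same root-to-vertex paths. -/
def Equiv (T₁ T₂ : RTree V) : Prop := ∀ v, T₁.pathSet v = T₂.pathSet v

end RTree

/-- `x` and `y` are joined by a walk of `G` staying inside `s`. -/
def ReachIn (G : SimpleGraph V) (s : Set V) (x y : V) : Prop :=
  ∃ p : G.Walk x y, ∀ v ∈ p.support, v ∈ s

/-- The connected component of `x` in the subgraph of `G` induced by `s`. -/
def compIn (G : SimpleGraph V) (s : Set V) (x : V) : Set V := {y | ReachIn G s x y}

/-- The set of connected components of the subgraph of `G` induced by `s`. -/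
def comps (G : SimpleGraph V) (s : Set V) : Set (Set V) := {c | ∃ x ∈ s, c = compIn G s x}

/-- `s` induces a (nonempty) connected subgraph of `G`. -/
def ConnIn (G : SimpleGraph V) (s : Set V) : Prop :=
  s.Nonempty ∧ ∀ x ∈ s, ∀ y ∈ s, ReachIn G s x y

/-- The total weight of a set of vertices. -/
noncomputable def wsum (w : V → ℝ) (s : Set V) : ℝ := ∑ᶠ x ∈ s, w x

/-- `IsSearchTree G s T`: `T` is a search tree on the subgraph of `G` induced by `s`.
Its root `r` is a vertex of `s`, its vertex set is `s`, and the subtrees rooted at the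
children of `r` are search trees on the connected components of the induced subgraph
on `s \ {r}` (one subtree for each component). -/
inductive IsSearchTree (G : SimpleGraph V) : Set V → RTree V → Prop where
  | node {s : Set V} {r : V} {ts : List (RTree V)} :
      r ∈ s →
      (RTree.node r ts).vertSet = s →
      (∀ t ∈ ts, IsSearchTree G (compIn G (s \ {r}) t.root) t) →
      ts.Pairwise (fun t₁ t₂ => compIn G (s \ {r}) t₁.root ≠ compIn G (s \ {r}) t₂.root) →
      IsSearchTree G s (RTree.node r ts)

/-- The cost of a search tree: `∑_x w(x) · depth(x)`, the root having depth 1. -/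
noncomputable def cost (w : V → ℝ) (T : RTree V) : ℝ :=
  ∑ᶠ v ∈ T.vertSet, w v * (T.depth v : ℝ)

/-- The optimum cost of a search tree on the subgraph of `G` induced by `s`. -/
noncomputable def OPT (G : SimpleGraph V) (w : V → ℝ) (s : Set V) : ℝ :=
  sInf (cost w '' {T | IsSearchTree G s T})

/-- `v` is an `α`-centroid of the subgraph of `G` induced by `s` (with weights `w`):
every connected component of the induced subgraph on `s \ {v}` has weight at most
`α` times the weight of `s`. -/
def IsAlphaCentroid (G : SimpleGraph V) (w : V → ℝ) (α : ℝ) (s : Set V) (v : V) : Prop :=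
  v ∈ s ∧ ∀ x ∈ s \ {v}, wsum w (compIn G (s \ {v}) x) ≤ α * wsum w s

/-- `v` is a centroid of the subgraph of `G` induced by `s` (with weights `w`). -/
def IsCentroid (G : SimpleGraph V) (w : V → ℝ) (s : Set V) (v : V) : Prop :=
  v ∈ s ∧ ∀ x ∈ s \ {v}, wsum w (compIn G (s \ {v}) x) ≤ wsum w s / 2

/-- `T` is an `α`-centroid tree on the subgraph of `G` induced by `s`. -/
def IsAlphaCentroidTree (G : SimpleGraph V) (w : V → ℝ) (α : ℝ) (s : Set V) (T : RTree V) :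
    Prop :=
  IsSearchTree G s T ∧ ∀ t ∈ T.allSubtrees, IsAlphaCentroid G w α t.vertSet t.root

/-- `T` is a centroid tree on the subgraph of `G` induced by `s`. -/
def IsCentroidTree (G : SimpleGraph V) (w : V → ℝ) (s : Set V) (T : RTree V) : Prop :=
  IsSearchTree G s T ∧ ∀ t ∈ T.allSubtrees, IsCentroid G w t.vertSet t.root

/-- `cent(𝒯,w)`: the maximum cost of a centroid tree. -/
noncomputable def centCost (G : SimpleGraph V) (w : V → ℝ) (s : Set V) : ℝ :=
  sSup (cost w '' {T | IsCentroidTree G w s T})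

/-- `centᵅ(𝒯,w)`: the maximum cost of an `α`-centroid tree (`0` if none exists, since
`sSup ∅ = 0` in `ℝ`). -/
noncomputable def centCostA (G : SimpleGraph V) (w : V → ℝ) (α : ℝ) (s : Set V) : ℝ :=
  sSup (cost w '' {T | IsAlphaCentroidTree G w α s T})

/-- `b` is a child of `a` in the rooted tree `T`. -/
def ChildRel (T : RTree V) (a b : V) : Prop :=
  ∃ t ∈ T.allSubtrees, t.root = a ∧ ∃ t' ∈ t.children, t'.root = b


namespace RTree

theorem pathsFrom_node (r : V) (ts : List (RTree V)) :
    (node r ts).pathsFrom =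
      (r, [r]) :: (ts.map fun t => t.pathsFrom.map fun p => (p.1, r :: p.2)).flatten := by
  rw [pathsFrom]
  congr 2
  exact List.attach_map_val (l := ts)
    (f := fun t : RTree V => t.pathsFrom.map fun p => (p.1, r :: p.2))

theorem mem_pathsFrom_node {r : V} {ts : List (RTree V)} {p : V × List V} :
    p ∈ (node r ts).pathsFrom ↔
      p = (r, [r]) ∨ ∃ t ∈ ts, ∃ q ∈ t.pathsFrom, p = (q.1, r :: q.2) := by
  simp only [pathsFrom_node, List.mem_cons, List.mem_flatten, List.mem_map]
  constructor
  · rintro (h | ⟨_, ⟨t, ht, rfl⟩, hp⟩)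
    · exact Or.inl h
    · obtain ⟨q, hq, rfl⟩ := List.mem_map.1 hp
      exact Or.inr ⟨t, ht, q, hq, rfl⟩
  · rintro (h | ⟨t, ht, q, hq, rfl⟩)
    · exact Or.inl h
    · exact Or.inr ⟨_, ⟨t, ht, rfl⟩, List.mem_map.2 ⟨q, hq, rfl⟩⟩

theorem allSubtrees_node (r : V) (ts : List (RTree V)) :
    (node r ts).allSubtrees = node r ts :: (ts.map fun t => t.allSubtrees).flatten := by
  rw [allSubtrees]
  congr 2
  exact List.attach_map_val (l := ts) (f := fun t : RTree V => t.allSubtrees)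

theorem self_mem_allSubtrees (T : RTree V) : T ∈ T.allSubtrees := by
  cases T with
  | node r ts => simp [allSubtrees_node]

theorem mem_allSubtrees_node_of_mem {r : V} {ts : List (RTree V)} {t t' : RTree V} (ht : t ∈ ts)
    (h : t' ∈ t.allSubtrees) : t' ∈ (node r ts).allSubtrees := by
  rw [allSubtrees_node]
  exact List.mem_cons_of_mem _ (List.mem_flatten.2 ⟨_, List.mem_map.2 ⟨t, ht, rfl⟩, h⟩)

theorem mem_vertSet_node {r : V} {ts : List (RTree V)} {x : V} :
    x ∈ (node r ts).vertSet ↔ x = r ∨ ∃ t ∈ ts, x ∈ t.vertSet := by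
  simp only [vertSet, Set.mem_ofPred_eq, mem_pathsFrom_node]
  constructor
  · rintro ⟨p, rfl | ⟨t, ht, q, hq, rfl⟩, rfl⟩
    · exact Or.inl rfl
    · exact Or.inr ⟨t, ht, q, hq, rfl⟩
  · rintro (rfl | ⟨t, ht, q, hq, rfl⟩)
    · exact ⟨_, Or.inl rfl, rfl⟩
    · exact ⟨_, Or.inr ⟨t, ht, q, hq, rfl⟩, rfl⟩

theorem finite_pathSet (T : RTree V) (v : V) : (T.pathSet v).Finite := by
  have h : T.pathSet v ⊆ {x | x ∈ (T.pathsFrom.map Prod.snd).flatten} := by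
    rintro x ⟨p, hp, -, hx⟩
    exact List.mem_flatten.2 ⟨_, List.mem_map.2 ⟨p, hp, rfl⟩, hx⟩
  exact (List.finite_toSet _).subset h

theorem mem_vertSet_of_mem_path :
    ∀ (T : RTree V) (p : V × List V), p ∈ T.pathsFrom → ∀ x ∈ p.2, x ∈ T.vertSet
  | node r ts, p, hp, x, hx => by
    rcases mem_pathsFrom_node.1 hp with rfl | ⟨t, ht, q, hq, rfl⟩
    · exact mem_vertSet_node.2 (Or.inl (List.mem_singleton.1 hx))
    · rcases List.mem_cons.1 hx with rfl | hx
      · exact mem_vertSet_node.2 (Or.inl rfl)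
      · exact mem_vertSet_node.2 (Or.inr ⟨t, ht, mem_vertSet_of_mem_path t q hq x hx⟩)

theorem pathSet_subset_vertSet (T : RTree V) (v : V) : T.pathSet v ⊆ T.vertSet := by
  rintro x ⟨p, hp, -, hx⟩
  exact mem_vertSet_of_mem_path T p hp x hx

end RTree

section Reach

variable {G : SimpleGraph V} {s s' : Set V} {x y z : V}

theorem ReachIn.mem_left (h : ReachIn G s x y) : x ∈ s :=
  let ⟨p, hp⟩ := h
  hp x p.start_mem_support

theorem ReachIn.mem_right (h : ReachIn G s x y) : y ∈ s :=
  let ⟨p, hp⟩ := h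
  hp y p.end_mem_support

theorem ReachIn.refl (hx : x ∈ s) : ReachIn G s x x :=
  ⟨.nil, by simpa using hx⟩

theorem ReachIn.symm (h : ReachIn G s x y) : ReachIn G s y x :=
  let ⟨p, hp⟩ := h
  ⟨p.reverse, by simpa using hp⟩

theorem ReachIn.trans (h : ReachIn G s x y) (h' : ReachIn G s y z) : ReachIn G s x z := by
  obtain ⟨p, hp⟩ := h
  obtain ⟨q, hq⟩ := h'
  refine ⟨p.append q, fun v hv => ?_⟩
  rcases (SimpleGraph.Walk.mem_support_append_iff _ _).1 hv with hv | hv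
  exacts [hp v hv, hq v hv]

theorem ReachIn.mono (hs : s ⊆ s') (h : ReachIn G s x y) : ReachIn G s' x y :=
  let ⟨p, hp⟩ := h
  ⟨p, fun v hv => hs (hp v hv)⟩

theorem ReachIn.cons (hx : x ∈ s) (hxy : G.Adj x y) (h : ReachIn G s y z) : ReachIn G s x z := by
  obtain ⟨p, hp⟩ := h
  refine ⟨.cons hxy p, fun v hv => ?_⟩
  rcases List.mem_cons.1 (SimpleGraph.Walk.support_cons hxy p ▸ hv) with rfl | hv
  exacts [hx, hp v hv]

theorem ReachIn.of_adj (hx : x ∈ s) (hy : y ∈ s) (hxy : G.Adj x y) : ReachIn G s x y :=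
  .cons hx hxy (.refl hy)

/-- Induction on a walk inside `s`, with fixed endpoint. -/
theorem ReachIn.head_induction {P : V → Prop} (h : ReachIn G s x y) (refl : P y)
    (head : ∀ a b, a ∈ s → G.Adj a b → ReachIn G s b y → P b → P a) : P x := by
  obtain ⟨p, hp⟩ := h
  induction p with
  | nil => exact refl
  | cons hab p ih =>
    have hp' : ∀ v ∈ p.support, v ∈ s := fun v hv => hp v (by simp [hv])
    exact head _ _ (hp _ (by simp)) hab ⟨p, hp'⟩ (ih refl head hp')

theorem ReachIn.mem_of_closed {A : Set V} (h : ReachIn G s x y) (hy : y ∈ A)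
    (hA : ∀ a ∈ s, ∀ b ∈ A, G.Adj a b → a ∈ A) : x ∈ A :=
  h.head_induction (P := (· ∈ A)) hy fun a b ha hab _ hb => hA a ha b hb hab

theorem ReachIn.within_compIn (h : ReachIn G s x y) : ReachIn G (compIn G s y) x y :=
  h.head_induction (P := fun x => ReachIn G (compIn G s y) x y) (.refl (.refl h.mem_right))
    fun _ _ ha hab hb ih => .cons (ReachIn.cons ha hab hb).symm hab ih

theorem ReachIn.map {W : Type*} {H : SimpleGraph W} (f : G →g H) {t : Set W}
    (hf : Set.MapsTo f s t) (h : ReachIn G s x y) : ReachIn H t (f x) (f y) :=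
  h.head_induction (P := fun x => ReachIn H t (f x) (f y)) (.refl (hf h.mem_right))
    fun _ _ ha hab _ ih => .cons (hf ha) (f.map_adj hab) ih

theorem compIn_eq_of_mem (h : y ∈ compIn G s x) : compIn G s y = compIn G s x :=
  Set.ext fun _ => ⟨fun hz => ReachIn.trans h hz, fun hz => ReachIn.trans (ReachIn.symm h) hz⟩

theorem compIn_subset : compIn G s x ⊆ s := fun _ h => ReachIn.mem_right h

theorem connIn_compIn (hx : x ∈ s) : ConnIn G (compIn G s x) := by
  refine ⟨⟨x, .refl hx⟩, fun y hy z hz => ?_⟩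
  have h := ReachIn.within_compIn (ReachIn.trans (ReachIn.symm hy) hz)
  rwa [compIn_eq_of_mem hz] at h

end Reach

/-- `d` is a vertex ranking of the subgraph of `G` induced by `s`: it is positive on `s`, and any
two vertices of equal rank are separated by vertices of smaller rank. -/
def IsRanking (G : SimpleGraph V) (s : Set V) (d : V → ℕ) : Prop :=
  (∀ x ∈ s, 1 ≤ d x) ∧ ∀ x y, x ≠ y → d x = d y → ¬ ReachIn G {z | z ∈ s ∧ d x ≤ d z} x y

section SearchTree

variable {G : SimpleGraph V} {s : Set V} {r : V} {ts : List (RTree V)} {t : RTree V} {x : V}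

theorem IsSearchTree.vertSet_eq {T : RTree V} (h : IsSearchTree G s T) : T.vertSet = s := by
  cases h with
  | node _ h _ _ => exact h

theorem IsSearchTree.root_mem {T : RTree V} (h : IsSearchTree G s T) : T.root ∈ s := by
  cases h with
  | node h _ _ _ => exact h

/-- The subtree at a child of the root of a search tree is a search tree on a component. -/
theorem IsSearchTree.child (h : IsSearchTree G s (.node r ts)) (ht : t ∈ ts) :
    IsSearchTree G (compIn G (s \ {r}) t.root) t := by
  cases h with
  | node _ _ h _ => exact h t ht

theorem IsSearchTree.eq_of_mem_vertSet (h : IsSearchTree G s (.node r ts)) {t' : RTree V}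
    (ht : t ∈ ts) (ht' : t' ∈ ts) (hx : x ∈ t.vertSet) (hx' : x ∈ t'.vertSet) : t = t' := by
  by_contra hne
  rw [(h.child ht).vertSet_eq] at hx
  rw [(h.child ht').vertSet_eq] at hx'
  cases h with
  | node _ _ _ hp =>
    have : Std.Symm fun t₁ t₂ : RTree V =>
        compIn G (s \ {r}) t₁.root ≠ compIn G (s \ {r}) t₂.root := ⟨fun _ _ h => h.symm⟩
    exact hp.forall ht ht' hne
      ((compIn_eq_of_mem hx).symm.trans (compIn_eq_of_mem hx'))

theorem IsSearchTree.root_notMem_child (h : IsSearchTree G s (.node r ts)) (ht : t ∈ ts) :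
    r ∉ t.vertSet := by
  rw [(h.child ht).vertSet_eq]
  exact fun hr => (compIn_subset hr).2 rfl

theorem IsSearchTree.exists_child_of_mem (h : IsSearchTree G s (.node r ts)) (hx : x ∈ s)
    (hxr : x ≠ r) : ∃ t ∈ ts, x ∈ t.vertSet := by
  rw [← h.vertSet_eq, RTree.mem_vertSet_node] at hx
  exact hx.resolve_left hxr

theorem IsSearchTree.depth_root (h : IsSearchTree G s (.node r ts)) :
    (RTree.node r ts).depth r = 1 := by
  have : (RTree.node r ts).pathSet r = {r} := by
    ext x
    constructor
    · rintro ⟨p, hp, hpr, hx⟩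
      rcases RTree.mem_pathsFrom_node.1 hp with rfl | ⟨t, ht, q, hq, rfl⟩
      · simpa using hx
      · exact absurd ⟨q, hq, hpr⟩ (h.root_notMem_child ht)
    · rintro rfl
      exact ⟨_, RTree.mem_pathsFrom_node.2 (Or.inl rfl), rfl, by simp⟩
  rw [RTree.depth, this, Set.ncard_singleton]

theorem IsSearchTree.depth_child (h : IsSearchTree G s (.node r ts)) (ht : t ∈ ts)
    (hx : x ∈ t.vertSet) : (RTree.node r ts).depth x = t.depth x + 1 := by
  have : (RTree.node r ts).pathSet x = insert r (t.pathSet x) := by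
    ext y
    constructor
    · rintro ⟨p, hp, hpx, hy⟩
      rcases RTree.mem_pathsFrom_node.1 hp with rfl | ⟨t', ht', q, hq, rfl⟩
      · exact Or.inl (by simpa using hy)
      · have : t = t' := h.eq_of_mem_vertSet ht ht' hx ⟨q, hq, hpx⟩
        subst this
        rcases List.mem_cons.1 hy with rfl | hy
        · exact Or.inl rfl
        · exact Or.inr ⟨q, hq, hpx, hy⟩
    · rintro (rfl | ⟨q, hq, hqx, hy⟩)
      · obtain ⟨q, hq, hqx⟩ := hx
        exact ⟨_, RTree.mem_pathsFrom_node.2 (Or.inr ⟨t, ht, q, hq, rfl⟩), hqx, by simp⟩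
      · exact ⟨_, RTree.mem_pathsFrom_node.2 (Or.inr ⟨t, ht, q, hq, rfl⟩), hqx, by simp [hy]⟩
  rw [RTree.depth, this, Set.ncard_insert_of_notMem _ (t.finite_pathSet x), RTree.depth]
  exact fun hr => h.root_notMem_child ht (t.pathSet_subset_vertSet x hr)

/-- The depth function of a search tree is a vertex ranking. -/
theorem IsSearchTree.isRanking_depth {T : RTree V} (h : IsSearchTree G s T) :
    IsRanking G s T.depth := by
  induction h with
  | @node s r ts hr hv hc hp ih =>
    have h : IsSearchTree G s (.node r ts) := .node hr hv hc hp
    have hchild : ∀ x ∈ s, x ≠ r → 2 ≤ (RTree.node r ts).depth x := by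
      intro x hx hxr
      obtain ⟨t, ht, hxt⟩ := h.exists_child_of_mem hx hxr
      have := (ih t ht).1 x ((h.child ht).vertSet_eq ▸ hxt)
      rw [h.depth_child ht hxt]
      omega
    refine ⟨fun x hx => ?_, fun x y hxy hd hreach => ?_⟩
    · rcases eq_or_ne x r with rfl | hxr
      · exact h.depth_root.ge
      · exact (hchild x hx hxr).trans' one_le_two
    · have hx := hreach.mem_left.1
      have hy := hreach.mem_right.1
      have hxr : x ≠ r := by
        rintro rfl
        have := hchild y hy hxy.symm
        rw [← hd, h.depth_root] at this
        omega
      have hx2 := hchild x hx hxr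
      obtain ⟨t, ht, hxt⟩ := h.exists_child_of_mem hx hxr
      have hxt' := (h.child ht).vertSet_eq ▸ hxt
      have key : ReachIn G (s \ {r}) x y := hreach.mono fun z hz => ⟨hz.1, by
        rintro rfl
        have := hz.2
        rw [h.depth_root] at this
        omega⟩
      have hyt' : y ∈ compIn G (s \ {r}) t.root := ReachIn.trans hxt' key
      have hyt := (h.child ht).vertSet_eq.symm ▸ hyt'
      have hdx := h.depth_child ht hxt
      have hdy := h.depth_child ht hyt
      refine (ih t ht).2 x y hxy (by omega) ?_
      refine hreach.head_induction (P := fun a => ReachIn G {z | z ∈ compIn G (s \ {r}) t.root ∧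
        t.depth x ≤ t.depth z} a y) (.refl ⟨hyt', by omega⟩) fun a b ha hab _ ihb => ?_
      have har : a ≠ r := by
        rintro rfl
        have := ha.2
        rw [h.depth_root] at this
        omega
      have hat' : a ∈ compIn G (s \ {r}) t.root := by
        have hb := ihb.mem_left.1
        exact ReachIn.trans hb (.of_adj (ReachIn.mem_right hb) ⟨ha.1, har⟩ hab.symm)
      have hda := h.depth_child ht ((h.child ht).vertSet_eq.symm ▸ hat')
      have := ha.2
      exact .cons ⟨hat', by omega⟩ hab ihb

/-- Every vertex ranking of a connected set dominates the depth function of some search tree. -/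
theorem IsRanking.exists_isSearchTree [Finite V] {d : V → ℕ} (hd : IsRanking G s d)
    (hs : ConnIn G s) : ∃ T, IsSearchTree G s T ∧ ∀ x ∈ s, T.depth x ≤ d x := by
  induction hn : s.ncard using Nat.strong_induction_on generalizing s d with
  | _ n ih =>
    obtain ⟨r, hr, hmin⟩ := Set.exists_min_image s d s.toFinite hs.1
    have hlt : ∀ x ∈ s, x ≠ r → d r < d x := by
      intro x hx hxr
      refine lt_of_le_of_ne (hmin x hx) fun he => ?_
      refine hd.2 r x hxr.symm he ((hs.2 r hr x hx).mono fun z hz => ⟨hz, hmin z hz⟩)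
    have hsub : ∀ c ∈ comps G (s \ {r}), c ⊆ s \ {r} := by
      rintro c ⟨x, -, rfl⟩
      exact compIn_subset
    have hc : ∀ c ∈ comps G (s \ {r}), ∃ T, IsSearchTree G c T ∧
        ∀ x ∈ c, T.depth x ≤ d x - 1 := by
      intro c hc
      have hcs := hsub c hc
      refine ih _ ?_ (d := fun x => d x - 1) ⟨fun x hx => ?_, fun x y hxy he hreach => ?_⟩ ?_ rfl
      · rw [← hn]
        exact Set.ncard_lt_ncard ((Set.ssubset_iff_of_subset (hcs.trans Set.sdiff_subset)).2
          ⟨r, hr, fun h => (hcs h).2 rfl⟩) s.toFinite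
      · have := hlt x (hcs hx).1 (hcs hx).2
        have := hd.1 r hr
        change 1 ≤ d x - 1
        omega
      · have hx := hcs hreach.mem_left.1
        have hy := hcs hreach.mem_right.1
        have h1 := hd.1 x hx.1
        have h2 := hd.1 y hy.1
        simp only at he
        refine hd.2 x y hxy (by omega) (hreach.mono fun z hz => ?_)
        have h3 := hd.1 z (hcs hz.1).1
        have h4 : d x - 1 ≤ d z - 1 := hz.2
        exact ⟨(hcs hz.1).1, by omega⟩
      · obtain ⟨x, hx, rfl⟩ := hc
        exact connIn_compIn hx
    have : Nonempty (RTree V) := ⟨.node r []⟩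
    choose! f hf hfd using hc
    set ts := (comps G (s \ {r})).toFinite.toFinset.toList.map f with hts
    have hmem : ∀ t, t ∈ ts ↔ ∃ c ∈ comps G (s \ {r}), f c = t := by
      simp [hts]
    have hroot : ∀ c ∈ comps G (s \ {r}), compIn G (s \ {r}) (f c).root = c := by
      intro c hc
      have := (hf c hc).root_mem
      obtain ⟨x, hx, rfl⟩ := hc
      exact compIn_eq_of_mem this
    have hT : IsSearchTree G s (.node r ts) := by
      refine .node hr ?_ ?_ ?_
      · ext x
        rw [RTree.mem_vertSet_node]
        constructor
        · rintro (rfl | ⟨t, ht, hx⟩)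
          · exact hr
          · obtain ⟨c, hc, rfl⟩ := (hmem t).1 ht
            rw [(hf c hc).vertSet_eq] at hx
            exact (hsub c hc hx).1
        · intro hx
          refine or_iff_not_imp_left.2 fun hxr => ?_
          have hc : compIn G (s \ {r}) x ∈ comps G (s \ {r}) := ⟨x, ⟨hx, hxr⟩, rfl⟩
          refine ⟨_, (hmem _).2 ⟨_, hc, rfl⟩, ?_⟩
          rw [(hf _ hc).vertSet_eq]
          exact .refl ⟨hx, hxr⟩
      · intro t ht
        obtain ⟨c, hc, rfl⟩ := (hmem t).1 ht
        rw [hroot c hc]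
        exact hf c hc
      · rw [hts, List.pairwise_map]
        refine (Finset.nodup_toList _).imp_of_mem fun ha hb hab => ?_
        simp only [Finset.mem_toList, Set.Finite.mem_toFinset] at ha hb
        rwa [hroot _ ha, hroot _ hb]
    refine ⟨_, hT, fun x hx => ?_⟩
    rcases eq_or_ne x r with rfl | hxr
    · exact hT.depth_root.le.trans (hd.1 x hx)
    · obtain ⟨t, ht, hxt⟩ := hT.exists_child_of_mem hx hxr
      obtain ⟨c, hc, rfl⟩ := (hmem t).1 ht
      rw [hT.depth_child ht hxt]
      have := hfd c hc x ((hf c hc).vertSet_eq ▸ hxt)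
      have := hlt x hx hxr
      omega

end SearchTree

section Weight

variable {G : SimpleGraph V} {w : V → ℝ} {s t A B : Set V}

theorem wsum_eq_sum [Finite V] (w : V → ℝ) (s : Set V) :
    wsum w s = ∑ x ∈ s.toFinite.toFinset, w x :=
  finsum_mem_eq_finite_toFinset_sum _ _

theorem wsum_mono [Finite V] (hw : ∀ x, 0 ≤ w x) (h : s ⊆ t) : wsum w s ≤ wsum w t := by
  rw [wsum_eq_sum, wsum_eq_sum]
  exact Finset.sum_le_sum_of_subset_of_nonneg (Set.Finite.toFinset_mono h) fun x _ _ => hw x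

theorem wsum_union [Finite V] (w : V → ℝ) (h : Disjoint s t) :
    wsum w (s ∪ t) = wsum w s + wsum w t :=
  finsum_mem_union h s.toFinite t.toFinite

theorem wsum_insert [Finite V] (w : V → ℝ) {v : V} (h : v ∉ s) :
    wsum w (insert v s) = w v + wsum w s :=
  finsum_mem_insert _ h s.toFinite

theorem wsum_univ [Fintype V] (w : V → ℝ) : wsum w Set.univ = ∑ x, w x := by
  rw [wsum, finsum_mem_univ, finsum_eq_sum_of_fintype]

theorem IsSearchTree.cost_eq {T : RTree V} (hT : IsSearchTree G s T) :
    cost w T = wsum (fun x => w x * (T.depth x : ℝ)) s := by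
  rw [cost, wsum, hT.vertSet_eq]

theorem SimpleGraph.Connected.connIn_univ (hG : G.Connected) : ConnIn G Set.univ :=
  ⟨⟨hG.nonempty.some, trivial⟩, fun x _ y _ =>
    let ⟨p⟩ := hG.preconnected x y
    ⟨p, fun _ _ => trivial⟩⟩

theorem OPT_le_of_isRanking [Fintype V] (hG : G.Connected) (hw : ∀ x, 0 ≤ w x) {d : V → ℕ}
    (hd : IsRanking G Set.univ d) : OPT G w Set.univ ≤ ∑ x, w x * (d x : ℝ) := by
  obtain ⟨T, hT, hTd⟩ := hd.exists_isSearchTree hG.connIn_univ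
  have hmem : cost w T ∈ cost w '' {T | IsSearchTree G Set.univ T} := ⟨T, hT, rfl⟩
  have hbdd : BddBelow (cost w '' {T | IsSearchTree G Set.univ T}) := by
    refine ⟨0, ?_⟩
    rintro _ ⟨T', hT', rfl⟩
    rw [IsSearchTree.cost_eq hT', wsum_univ]
    exact Finset.sum_nonneg fun x _ => mul_nonneg (hw x) (Nat.cast_nonneg _)
  refine (csInf_le hbdd hmem).trans ?_
  rw [hT.cost_eq, wsum_univ]
  exact Finset.sum_le_sum fun x _ =>
    mul_le_mul_of_nonneg_left (Nat.cast_le.2 (hTd x trivial)) (hw x)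

theorem le_OPT_of_isRanking [Fintype V] (hG : G.Connected) {d₀ : V → ℕ}
    (hd₀ : IsRanking G Set.univ d₀) {r : ℝ}
    (h : ∀ d, IsRanking G Set.univ d → r ≤ ∑ x, w x * (d x : ℝ)) : r ≤ OPT G w Set.univ := by
  obtain ⟨T, hT, -⟩ := hd₀.exists_isSearchTree hG.connIn_univ
  refine le_csInf ⟨_, T, hT, rfl⟩ ?_
  rintro _ ⟨T', hT', rfl⟩
  rw [IsSearchTree.cost_eq hT', wsum_univ]
  exact h _ (IsSearchTree.isRanking_depth hT')

/-- A centroid does not lie in one of two parts of equal weight that are joined only through a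
vertex of positive weight. -/
theorem IsCentroid.notMem_of_wsum_eq [Finite V] {v b r : V} (hw : ∀ x, 0 ≤ w x)
    (hB : ConnIn G B) (hAB : Disjoint A B) (hvA : v ∉ A) (hvB : v ∉ B) (hb : b ∈ B)
    (hvb : G.Adj v b) (hv : 0 < w v) (hW : wsum w A = wsum w B)
    (hr : IsCentroid G w (insert v (A ∪ B)) r) : r ∉ A := by
  intro hrA
  have hrB : r ∉ B := Set.disjoint_left.1 hAB hrA
  have hvr : v ≠ r := by
    rintro rfl
    exact hvA hrA
  have hvs : v ∈ insert v (A ∪ B) \ {r} := ⟨Or.inl rfl, hvr⟩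
  have hBs : B ⊆ insert v (A ∪ B) \ {r} := fun x hx =>
    ⟨Or.inr (Or.inr hx), fun h => hrB (Set.mem_singleton_iff.1 h ▸ hx)⟩
  have hsub : insert v B ⊆ compIn G (insert v (A ∪ B) \ {r}) v := by
    rintro x (rfl | hx)
    · exact .refl hvs
    · exact .cons hvs hvb ((hB.2 b hb x hx).mono hBs)
  have h1 := wsum_mono hw hsub
  have h2 := hr.2 v hvs
  rw [wsum_insert w hvB] at h1
  rw [wsum_insert w (by simp [hvA, hvB]), wsum_union w hAB] at h2
  linarith

theorem compIn_eq_of_connIn {a : V} (hA : ConnIn G A) (hAs : A ⊆ s) (ha : a ∈ A)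
    (hclosed : ∀ x ∈ s, ∀ y ∈ A, G.Adj x y → x ∈ A) : compIn G s a = A :=
  Set.Subset.antisymm (fun _ hx => (ReachIn.symm hx).mem_of_closed ha hclosed)
    fun _ hx => (hA.2 a ha _ hx).mono hAs

/-- A centroid tree restricts to a centroid tree on each component left after deleting the root. -/
theorem IsCentroidTree.exists_child {r a : V} {ts : List (RTree V)}
    (hC : IsCentroidTree G w s (.node r ts)) (hA : ConnIn G A) (hAs : A ⊆ s \ {r}) (ha : a ∈ A)
    (hclosed : ∀ x ∈ s \ {r}, ∀ y ∈ A, G.Adj x y → x ∈ A) :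
    ∃ t ∈ ts, IsCentroidTree G w A t := by
  obtain ⟨t, ht, hat⟩ := hC.1.exists_child_of_mem (hAs ha).1 (hAs ha).2
  have hst := hC.1.child ht
  have : compIn G (s \ {r}) t.root = A := by
    rw [← compIn_eq_of_connIn hA hAs ha hclosed]
    exact (compIn_eq_of_mem (hst.vertSet_eq ▸ hat)).symm
  rw [this] at hst
  exact ⟨t, ht, hst, fun t' ht' => hC.2 t' (RTree.mem_allSubtrees_node_of_mem ht ht')⟩

theorem IsSearchTree.wsum_depth_child [Finite V] {r : V} {ts : List (RTree V)} {t : RTree V}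
    (h : IsSearchTree G s (.node r ts)) (ht : t ∈ ts) (hA : IsSearchTree G A t) :
    wsum (fun x => w x * ((RTree.node r ts).depth x : ℝ)) A = wsum w A + cost w t := by
  rw [hA.cost_eq, wsum_eq_sum, wsum_eq_sum, wsum_eq_sum, ← Finset.sum_add_distrib]
  refine Finset.sum_congr rfl fun x hx => ?_
  rw [h.depth_child ht (hA.vertSet_eq.symm ▸ (Set.Finite.mem_toFinset _).1 hx)]
  push_cast
  ring

/-- A centroid tree on two connected parts of equal weight joined through a vertex of positive
weight has that vertex as its root, with centroid trees of the parts below it. -/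
theorem IsCentroidTree.exists_cost_eq [Finite V] {v a b : V} (hw : ∀ x, 0 ≤ w x)
    (hA : ConnIn G A) (hB : ConnIn G B) (hAB : Disjoint A B) (hvA : v ∉ A) (hvB : v ∉ B)
    (ha : a ∈ A) (hb : b ∈ B) (hva : G.Adj v a) (hvb : G.Adj v b)
    (hno : ∀ x ∈ A, ∀ y ∈ B, ¬ G.Adj x y) (hv : 0 < w v) (hW : wsum w A = wsum w B)
    {C : RTree V} (hC : IsCentroidTree G w (insert v (A ∪ B)) C) :
    ∃ CA CB, IsCentroidTree G w A CA ∧ IsCentroidTree G w B CB ∧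
      cost w C = wsum w (insert v (A ∪ B)) + cost w CA + cost w CB := by
  obtain ⟨r, ts⟩ := C
  have hr : IsCentroid G w (insert v (A ∪ B)) r := by
    have := hC.2 _ (RTree.self_mem_allSubtrees _)
    rwa [hC.1.vertSet_eq] at this
  have hrA := hr.notMem_of_wsum_eq hw hB hAB hvA hvB hb hvb hv hW
  have hrB : r ∉ B := by
    rw [Set.union_comm] at hr
    exact hr.notMem_of_wsum_eq hw hA hAB.symm hvB hvA ha hva hv hW.symm
  obtain rfl : r = v := by
    rcases hr.1 with h | h | h
    exacts [h, absurd h hrA, absurd h hrB]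
  have hAs : A ⊆ insert r (A ∪ B) \ {r} := fun x hx =>
    ⟨Or.inr (Or.inl hx), fun h => hvA (Set.mem_singleton_iff.1 h ▸ hx)⟩
  have hBs : B ⊆ insert r (A ∪ B) \ {r} := fun x hx =>
    ⟨Or.inr (Or.inr hx), fun h => hvB (Set.mem_singleton_iff.1 h ▸ hx)⟩
  obtain ⟨tA, htA, hCA⟩ := hC.exists_child hA hAs ha fun x hx y hy hxy => by
    rcases hx with ⟨rfl | hx | hx, hxr⟩
    exacts [absurd rfl hxr, hx, absurd hxy.symm (hno y hy x hx)]
  obtain ⟨tB, htB, hCB⟩ := hC.exists_child hB hBs hb fun x hx y hy hxy => by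
    rcases hx with ⟨rfl | hx | hx, hxr⟩
    exacts [absurd rfl hxr, absurd hxy (hno x hx y hy), hx]
  refine ⟨tA, tB, hCA, hCB, ?_⟩
  have hv' : r ∉ A ∪ B := by simp [hvA, hvB]
  rw [hC.1.cost_eq, wsum_insert _ hv', wsum_insert _ hv', wsum_union _ hAB, wsum_union _ hAB,
    hC.1.wsum_depth_child htA hCA.1, hC.1.wsum_depth_child htB hCB.1, hC.1.depth_root]
  push_cast
  ring

end Weight

theorem ncard_pair_le {α : Type*} (x y : α) : ({x, y} : Set α).ncard ≤ 2 :=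
  (Set.ncard_insert_le _ _).trans (by rw [Set.ncard_singleton])

section Join

variable {A B : Type} (GA : SimpleGraph A) (GB : SimpleGraph B) (a : A) (b : B)

/-- The disjoint union of two graphs together with a new vertex `none` adjacent to `a` and `b`. -/
def joinGraph : SimpleGraph (Option (A ⊕ B)) where
  Adj
    | some (.inl x), some (.inl y) => GA.Adj x y
    | some (.inr x), some (.inr y) => GB.Adj x y
    | none, some (.inl x) => x = a
    | some (.inl x), none => x = a
    | none, some (.inr y) => y = b
    | some (.inr y), none => y = b
    | _, _ => False
  symm := ⟨by
    rintro (_ | x | x) (_ | y | y) h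
    all_goals first | exact h | exact SimpleGraph.Adj.symm h⟩
  loopless := ⟨by
    rintro (_ | x | x) h
    exacts [h, GA.loopless.irrefl x h, GB.loopless.irrefl x h]⟩

/-- A function on the vertices of a joined graph, scaled so that the new vertex has weight `μ`. -/
noncomputable def joinWeight (μ : ℝ) (wA : A → ℝ) (wB : B → ℝ) : Option (A ⊕ B) → ℝ
  | none => μ
  | some (.inl x) => (1 - μ) / 2 * wA x
  | some (.inr x) => (1 - μ) / 2 * wB x

/-- The rank function on a joined graph giving rank `m` to the new vertex. -/
def joinRank (m : ℕ) (dA : A → ℕ) (dB : B → ℕ) : Option (A ⊕ B) → ℕ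
  | none => m
  | some (.inl x) => dA x
  | some (.inr x) => dB x

/-- The left part of a joined graph. -/
def joinInl : GA ↪g joinGraph GA GB a b where
  toFun x := some (.inl x)
  inj' _ _ h := Sum.inl_injective (Option.some_injective _ h)
  map_rel_iff' := Iff.rfl

/-- The right part of a joined graph. -/
def joinInr : GB ↪g joinGraph GA GB a b where
  toFun x := some (.inr x)
  inj' _ _ h := Sum.inr_injective (Option.some_injective _ h)
  map_rel_iff' := Iff.rfl

variable {GA GB a b}

theorem joinInl_apply (x : A) : joinInl GA GB a b x = some (.inl x) := rfl

theorem joinInr_apply (x : B) : joinInr GA GB a b x = some (.inr x) := rfl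

theorem joinGraph_connected (hA : GA.Connected) (hB : GB.Connected) :
    (joinGraph GA GB a b).Connected := by
  have ha : (joinGraph GA GB a b).Adj none (some (.inl a)) := rfl
  have hb : (joinGraph GA GB a b).Adj none (some (.inr b)) := rfl
  have h : ∀ x, (joinGraph GA GB a b).Reachable none x := by
    rintro (_ | x | x)
    · exact .refl _
    · exact ha.reachable.trans ((hA.preconnected a x).map (joinInl GA GB a b).toHom)
    · exact hb.reachable.trans ((hB.preconnected b x).map (joinInr GA GB a b).toHom)
  have : Nonempty (Option (A ⊕ B)) := ⟨none⟩
  exact ⟨fun x y => (h x).symm.trans (h y)⟩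

theorem joinGraph_isTree [Finite A] [Finite B] (hA : GA.IsTree) (hB : GB.IsTree) :
    (joinGraph GA GB a b).IsTree := by
  have hc := joinGraph_connected (a := a) (b := b) hA.connected hB.connected
  refine SimpleGraph.isTree_iff_connected_and_card.2 ⟨hc, le_antisymm ?_ ?_⟩
  · have hsub : (joinGraph GA GB a b).edgeSet ⊆
        (Sym2.map (joinInl GA GB a b) '' GA.edgeSet ∪ Sym2.map (joinInr GA GB a b) '' GB.edgeSet) ∪
          {s(none, some (.inl a)), s(none, some (.inr b))} := by
      intro e
      induction e with
      | _ x y =>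
        rw [SimpleGraph.mem_edgeSet]
        rcases x with _ | x | x <;> rcases y with _ | y | y <;> intro h
        · exact h.elim
        · exact Or.inr (Or.inl (by rw [show y = a from h]))
        · exact Or.inr (Or.inr (by rw [show y = b from h]; rfl))
        · exact Or.inr (Or.inl (by rw [show x = a from h, Sym2.eq_swap]))
        · exact Or.inl (Or.inl ⟨s(x, y), h, rfl⟩)
        · exact h.elim
        · exact Or.inr (Or.inr (by rw [show x = b from h, Sym2.eq_swap]; rfl))
        · exact h.elim
        · exact Or.inl (Or.inr ⟨s(x, y), h, rfl⟩)
    have h1 := Set.ncard_le_ncard hsub (Set.toFinite _)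
    have h2 := Set.ncard_union_le (Sym2.map (joinInl GA GB a b) '' GA.edgeSet ∪
      Sym2.map (joinInr GA GB a b) '' GB.edgeSet) {s(none, some (.inl a)), s(none, some (.inr b))}
    have h3 := Set.ncard_union_le (Sym2.map (joinInl GA GB a b) '' GA.edgeSet)
      (Sym2.map (joinInr GA GB a b) '' GB.edgeSet)
    have h4 := Set.ncard_image_le (f := Sym2.map (joinInl GA GB a b)) (Set.toFinite GA.edgeSet)
    have h5 := Set.ncard_image_le (f := Sym2.map (joinInr GA GB a b)) (Set.toFinite GB.edgeSet)
    have h6 : ({s(none, some (.inl a)), s(none, some (.inr b))} :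
        Set (Sym2 (Option (A ⊕ B)))).ncard ≤ 2 := ncard_pair_le _ _
    have hA' := (SimpleGraph.isTree_iff_connected_and_card.1 hA).2
    have hB' := (SimpleGraph.isTree_iff_connected_and_card.1 hB).2
    rw [Nat.card_coe_set_eq] at hA' hB' ⊢
    rw [Finite.card_option, Nat.card_sum]
    omega
  · exact hc.card_vert_le_card_edgeSet_add_one

theorem joinGraph_neighborSet_none :
    (joinGraph GA GB a b).neighborSet none = {some (.inl a), some (.inr b)} := by
  ext (_ | x | x) <;> simp [joinGraph]

theorem joinGraph_neighborSet_inl (x : A) :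
    (joinGraph GA GB a b).neighborSet (some (.inl x)) =
      (joinInl GA GB a b '' GA.neighborSet x) ∪ {z | z = none ∧ x = a} := by
  ext (_ | y | y) <;>
    simp only [Set.mem_union, Set.mem_image, joinInl_apply, SimpleGraph.mem_neighborSet] <;>
    simp [joinGraph]

theorem joinGraph_neighborSet_inr (x : B) :
    (joinGraph GA GB a b).neighborSet (some (.inr x)) =
      (joinInr GA GB a b '' GB.neighborSet x) ∪ {z | z = none ∧ x = b} := by
  ext (_ | y | y) <;>
    simp only [Set.mem_union, Set.mem_image, joinInr_apply, SimpleGraph.mem_neighborSet] <;>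
    simp [joinGraph]

theorem ncard_neighborSet_inl_of_ne [Finite A] {x : A} (hx : x ≠ a) :
    ((joinGraph GA GB a b).neighborSet (some (.inl x))).ncard ≤ (GA.neighborSet x).ncard := by
  simp only [joinGraph_neighborSet_inl, hx, and_false, Set.ofPred_false, Set.union_empty]
  exact Set.ncard_image_le (Set.toFinite _)

theorem ncard_neighborSet_inl_le [Finite A] (x : A) :
    ((joinGraph GA GB a b).neighborSet (some (.inl x))).ncard ≤ (GA.neighborSet x).ncard + 1 := by
  rw [joinGraph_neighborSet_inl]
  refine (Set.ncard_union_le _ _).trans (add_le_add (Set.ncard_image_le (Set.toFinite _)) ?_)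
  exact (Set.ncard_le_ncard (t := {none}) fun z hz => hz.1).trans (Set.ncard_singleton _).le

theorem ncard_neighborSet_inr_of_ne [Finite B] {x : B} (hx : x ≠ b) :
    ((joinGraph GA GB a b).neighborSet (some (.inr x))).ncard ≤ (GB.neighborSet x).ncard := by
  simp only [joinGraph_neighborSet_inr, hx, and_false, Set.ofPred_false, Set.union_empty]
  exact Set.ncard_image_le (Set.toFinite _)

theorem ncard_neighborSet_inr_le [Finite B] (x : B) :
    ((joinGraph GA GB a b).neighborSet (some (.inr x))).ncard ≤ (GB.neighborSet x).ncard + 1 := by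
  rw [joinGraph_neighborSet_inr]
  refine (Set.ncard_union_le _ _).trans (add_le_add (Set.ncard_image_le (Set.toFinite _)) ?_)
  exact (Set.ncard_le_ncard (t := {none}) fun z hz => hz.1).trans (Set.ncard_singleton _).le

theorem joinGraph_ncard_neighborSet_le [Finite A] [Finite B] {Δ : ℕ} (hΔ : 2 ≤ Δ)
    (hA : ∀ x, (GA.neighborSet x).ncard ≤ Δ) (hB : ∀ x, (GB.neighborSet x).ncard ≤ Δ)
    (ha : (GA.neighborSet a).ncard < Δ) (hb : (GB.neighborSet b).ncard < Δ) (z : Option (A ⊕ B)) :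
    ((joinGraph GA GB a b).neighborSet z).ncard ≤ Δ := by
  rcases z with _ | x | x
  · rw [joinGraph_neighborSet_none]
    exact (ncard_pair_le _ _).trans hΔ
  · rcases eq_or_ne x a with rfl | hx
    · exact (ncard_neighborSet_inl_le x).trans ha
    · exact (ncard_neighborSet_inl_of_ne hx).trans (hA x)
  · rcases eq_or_ne x b with rfl | hx
    · exact (ncard_neighborSet_inr_le x).trans hb
    · exact (ncard_neighborSet_inr_of_ne hx).trans (hB x)

theorem sum_joinWeight [Fintype A] [Fintype B] (μ : ℝ) (wA : A → ℝ) (wB : B → ℝ)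
    (f : Option (A ⊕ B) → ℝ) :
    ∑ z, joinWeight μ wA wB z * f z = μ * f none +
      (1 - μ) / 2 * (∑ x, wA x * f (some (.inl x)) + ∑ x, wB x * f (some (.inr x))) := by
  rw [Fintype.sum_option, Fintype.sum_sum_type, mul_add, Finset.mul_sum, Finset.mul_sum]
  simp only [joinWeight, mul_assoc]

/-- In a connected graph, a ranking attains its minimum only once. -/
theorem IsRanking.eq_of_forall_le {V : Type*} {G : SimpleGraph V} {d : V → ℕ}
    (hd : IsRanking G Set.univ d) (hG : G.Connected) {x y : V} (hx : ∀ z, d x ≤ d z)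
    (hxy : d x = d y) : x = y := by
  by_contra hne
  exact hd.2 x y hne hxy ((hG.connIn_univ.2 x trivial y trivial).mono fun z _ => ⟨trivial, hx z⟩)

theorem isRanking_joinRank {dA : A → ℕ} {dB : B → ℕ} {k : ℕ} (hGA : GA.Connected)
    (hA : IsRanking GA Set.univ dA) (hB : IsRanking GB Set.univ dB) (ha : dA a = 1)
    (hAk : ∀ x, dA x ≤ k + 1) (hBk : ∀ x, dB x ≤ k + 1) (hB2 : ∀ x, 2 ≤ dB x) (hb : dB b ≤ k) :
    IsRanking (joinGraph GA GB a b) Set.univ (joinRank (k + 1) dA dB) := by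
  refine ⟨?_, ?_⟩
  · rintro (_ | x | x) -
    exacts [k.succ_pos, hA.1 x trivial, hB.1 x trivial]
  intro x y hxy hd hreach
  set d := joinRank (k + 1) dA dB with hd_def
  have hk : 2 ≤ k := (hB2 b).trans hb
  have hle : ∀ z, d z ≤ k + 1 := by
    rintro (_ | z | z)
    exacts [le_rfl, hAk z, hBk z]
  have ha1 : ∀ z, d z = 1 → z = some (.inl a) := by
    rintro (_ | z | z) hz
    · exact absurd hz (by simp only [hd_def, joinRank]; omega)
    · have hz : dA z = 1 := hz
      rw [hA.eq_of_forall_le hGA (x := a) (y := z) (fun t => ha.trans_le (hA.1 t trivial))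
        (ha.trans hz.symm)]
    · have := hB2 z
      have hz : dB z = 1 := hz
      omega
  have hx2 : 2 ≤ d x := by
    by_contra hlt
    have hpos : 1 ≤ d x := by
      rcases x with _ | x | x
      exacts [k.succ_pos, hA.1 x trivial, hB.1 x trivial]
    have h1 : d x = 1 := by omega
    exact hxy ((ha1 x h1).trans (ha1 y (hd ▸ h1)).symm)
  have hnone : ∀ z : Option (A ⊕ B), z ≠ none → d none = d z →
      ¬ ReachIn (joinGraph GA GB a b) {t | t ∈ Set.univ ∧ d none ≤ d t} none z := by
    rintro z hz - hr
    refine hz (hr.symm.mem_of_closed (A := {none}) rfl ?_)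
    rintro (_ | t | t) ht _ rfl hadj
    · exact hadj.elim
    · rw [show t = a from hadj] at ht
      have : k + 1 ≤ dA a := ht.2
      omega
    · rw [show t = b from hadj] at ht
      have : k + 1 ≤ dB b := ht.2
      omega
  rcases y with _ | y | y
  · refine hnone x hxy hd.symm (hreach.symm.mono fun z hz => ⟨trivial, hd ▸ hz.2⟩)
  · have key : ∃ x', x = some (.inl x') ∧
        ReachIn GA {z | z ∈ Set.univ ∧ d x ≤ dA z} x' y := by
      refine hreach.head_induction (P := fun z => ∃ x', z = some (.inl x') ∧
        ReachIn GA {z | z ∈ Set.univ ∧ d x ≤ dA z} x' y)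
        ⟨y, rfl, .refl hreach.mem_right⟩ ?_
      rintro (_ | z | z) _ hz hadj hr ⟨t, rfl, ht⟩
      · rw [show t = a from hadj] at ht
        have : d x ≤ dA a := ht.mem_left.2
        omega
      · exact ⟨z, rfl, .cons hz hadj ht⟩
      · exact hadj.elim
    obtain ⟨x', rfl, hr⟩ := key
    exact hA.2 x' y (by rintro rfl; exact hxy rfl) hd hr
  · rcases x with _ | x | x
    · exact hnone _ hxy.symm hd hreach
    · have key : some (Sum.inl x) ∈ {z : Option (A ⊕ B) | ∀ t, z ≠ some (.inl t)} := by
        refine hreach.mem_of_closed (by simp) ?_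
        rintro (_ | z | z) hz (_ | t | t) ht hadj
        · exact ht
        · exact absurd rfl (ht t)
        · simp
        · rw [show z = a from hadj] at hz
          have : d (some (.inl x)) ≤ dA a := hz.2
          omega
        · exact absurd rfl (ht t)
        · exact hadj.elim
        · simp
        · exact hadj.elim
        · simp
      exact absurd rfl (key x)
    · have key : ∀ z : Option (A ⊕ B), ReachIn (joinGraph GA GB a b)
            {t | t ∈ Set.univ ∧ d (some (.inr x)) ≤ d t} z (some (.inr y)) →
          (z = none → ReachIn GB {t | t ∈ Set.univ ∧ dB x ≤ dB t} b y) ∧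
          ∀ t, z = some (.inr t) → ReachIn GB {t | t ∈ Set.univ ∧ dB x ≤ dB t} t y := by
        intro z hz
        refine hz.head_induction (P := fun z =>
          (z = none → ReachIn GB {t | t ∈ Set.univ ∧ dB x ≤ dB t} b y) ∧
          ∀ t, z = some (.inr t) → ReachIn GB {t | t ∈ Set.univ ∧ dB x ≤ dB t} t y) ?_ ?_
        · refine ⟨by simp, ?_⟩
          rintro t ht
          obtain rfl : y = t := Sum.inr_injective (Option.some_injective _ ht)
          exact .refl hz.mem_right
        · rintro (_ | s | s) (_ | t | t) hs hadj hr ⟨ih1, ih2⟩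
          · exact hadj.elim
          · rw [show t = a from hadj] at hr
            have : d (some (.inr x)) ≤ dA a := hr.mem_left.2
            omega
          · refine ⟨fun _ => ?_, by simp⟩
            obtain rfl : t = b := hadj
            exact ih2 t rfl
          · simp
          · simp
          · simp
          · refine ⟨by simp, fun u hu => ?_⟩
            obtain rfl : s = u := Sum.inr_injective (Option.some_injective _ hu)
            rw [show s = b from hadj]
            exact ih1 rfl
          · exact hadj.elim
          · refine ⟨by simp, fun u hu => ?_⟩
            obtain rfl : s = u := Sum.inr_injective (Option.some_injective _ hu)
            exact .cons hs hadj (ih2 t rfl)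
      exact hB.2 x y (by rintro rfl; exact hxy rfl) hd ((key _ hreach).2 x rfl)

/-- A ranking restricts to an induced subgraph, and may be lowered if positivity is kept. -/
theorem IsRanking.comp_sub {V W : Type*} {G : SimpleGraph V} {H : SimpleGraph W} {d : V → ℕ}
    (hd : IsRanking G Set.univ d) (φ : H ↪g G) (c : ℕ) (hc : ∀ x, c + 1 ≤ d (φ x)) :
    IsRanking H Set.univ fun x => d (φ x) - c := by
  refine ⟨fun x _ => Nat.le_sub_of_add_le' (hc x), fun x y hxy he hr => ?_⟩
  have hx := hc x
  have hy := hc y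
  refine hd.2 (φ x) (φ y) (fun h => hxy (φ.injective h)) (by simp only at he; omega)
    (hr.map φ.toHom fun z hz => ⟨trivial, ?_⟩)
  have hz' := hc z
  have h2 : d (φ x) - c ≤ d (φ z) - c := hz.2
  change d (φ x) ≤ d (φ z)
  omega

/-- Lower bound on the weighted sum of ranks in a joined graph. -/
theorem le_sum_joinWeight_mul [Fintype A] [Fintype B] {μ rA rB : ℝ} {wA : A → ℝ} {wB : B → ℝ}
    (hGA : GA.Connected) (hGB : GB.Connected) (hμ : 0 ≤ μ) (hμ1 : μ ≤ 1)
    (hA1 : ∑ x, wA x = 1) (hB1 : ∑ x, wB x = 1)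
    (hA : ∀ d, IsRanking GA Set.univ d → rA ≤ ∑ x, wA x * (d x : ℝ))
    (hB : ∀ d, IsRanking GB Set.univ d → rB ≤ ∑ x, wB x * (d x : ℝ))
    {d : Option (A ⊕ B) → ℕ} (hd : IsRanking (joinGraph GA GB a b) Set.univ d) :
    (1 - μ) / 2 * (rA + rB + 1) ≤ ∑ z, joinWeight μ wA wB z * (d z : ℝ) := by
  rw [sum_joinWeight μ wA wB fun z => (d z : ℝ)]
  have hA0 := hA _ (hd.comp_sub (joinInl GA GB a b) 0 fun x => by simpa using hd.1 _ trivial)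
  have hB0 := hB _ (hd.comp_sub (joinInr GA GB a b) 0 fun x => by simpa using hd.1 _ trivial)
  have key : rA + rB + 1 ≤
      ∑ x, wA x * (d (some (.inl x)) : ℝ) + ∑ x, wB x * (d (some (.inr x)) : ℝ) := by
    obtain ⟨m, hm⟩ := Finite.exists_min d
    have h2 : ∀ z, z ≠ m → 2 ≤ d z := by
      intro z hz
      have h1 := hd.1 m trivial
      have h3 := hm z
      have h4 : d m ≠ d z := fun h => hz
        (hd.eq_of_forall_le (joinGraph_connected hGA hGB) hm h).symm
      omega
    by_cases hmB : ∀ x : B, some (.inr x) ≠ m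
    · have := hB _ (hd.comp_sub (joinInr GA GB a b) 1 fun x => h2 _ (hmB x))
      have he : ∑ x, wB x * ((d (joinInr GA GB a b x) - 1 : ℕ) : ℝ) =
          ∑ x, wB x * (d (some (.inr x)) : ℝ) - 1 := by
        rw [← hB1, ← Finset.sum_sub_distrib]
        refine Finset.sum_congr rfl fun x _ => ?_
        rw [Nat.cast_sub (hd.1 _ trivial)]
        rw [joinInr_apply]
        push_cast
        ring
      rw [he] at this
      simp only [Nat.sub_zero] at hA0
      have : rA ≤ ∑ x, wA x * (d (some (.inl x)) : ℝ) := hA0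
      linarith
    · push Not at hmB
      obtain ⟨y, rfl⟩ := hmB
      have := hA _ (hd.comp_sub (joinInl GA GB a b) 1 fun x => h2 _ (by simp [joinInl_apply]))
      have he : ∑ x, wA x * ((d (joinInl GA GB a b x) - 1 : ℕ) : ℝ) =
          ∑ x, wA x * (d (some (.inl x)) : ℝ) - 1 := by
        rw [← hA1, ← Finset.sum_sub_distrib]
        refine Finset.sum_congr rfl fun x _ => ?_
        rw [Nat.cast_sub (hd.1 _ trivial)]
        rw [joinInl_apply]
        push_cast
        ring
      rw [he] at this
      simp only [Nat.sub_zero] at hB0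
      have : rB ≤ ∑ x, wB x * (d (some (.inr x)) : ℝ) := hB0
      linarith
  have h0 : 0 ≤ μ * (d none : ℝ) := by positivity
  have := mul_le_mul_of_nonneg_left key (show 0 ≤ (1 - μ) / 2 by linarith)
  linarith

/-- Every centroid tree on a weighted copy of `(H, ω)` that is an induced subgraph of some larger
graph has cost at least `l` times the scaling factor of the weights. -/
def CentroidCostGE (H : SimpleGraph A) (ω : A → ℝ) (l : ℝ) : Prop :=
  ∀ (V : Type) [Finite V] (G : SimpleGraph V) (φ : H ↪g G) (w : V → ℝ) (c : ℝ), 0 < c →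
    (∀ x, 0 ≤ w x) → (∀ x, w (φ x) = c * ω x) →
    ∀ C, IsCentroidTree G w (Set.range φ) C → c * l ≤ cost w C

theorem CentroidCostGE.mono {H : SimpleGraph A} {ω : A → ℝ} {l l' : ℝ}
    (h : CentroidCostGE H ω l) (hl : l' ≤ l) : CentroidCostGE H ω l' :=
  fun V _ G φ w c hc hw hφ C hC =>
    (mul_le_mul_of_nonneg_left hl hc.le).trans (h V G φ w c hc hw hφ C hC)

theorem wsum_range [Fintype A] {V : Type} {w : V → ℝ} {ω : A → ℝ} {c : ℝ} {f : A → V}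
    (hf : Function.Injective f) (h : ∀ x, w (f x) = c * ω x) (h1 : ∑ x, ω x = 1) :
    wsum w (Set.range f) = c := by
  rw [wsum, finsum_mem_range hf, finsum_eq_sum_of_fintype]
  simp only [h, ← Finset.mul_sum, h1, mul_one]

theorem connIn_range {V : Type} {H : SimpleGraph A} {G : SimpleGraph V} (φ : H ↪g G)
    (hH : H.Connected) : ConnIn G (Set.range φ) := by
  refine ⟨⟨_, hH.nonempty.some, rfl⟩, ?_⟩
  rintro _ ⟨x, rfl⟩ _ ⟨y, rfl⟩
  exact (hH.connIn_univ.2 x trivial y trivial).map φ.toHom fun z _ => ⟨z, rfl⟩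

theorem CentroidCostGE.join [Fintype A] [Fintype B] {μ lA lB : ℝ} {wA : A → ℝ} {wB : B → ℝ}
    (hGA : GA.Connected) (hGB : GB.Connected) (hμ : 0 < μ) (hμ1 : μ < 1)
    (hA1 : ∑ x, wA x = 1) (hB1 : ∑ x, wB x = 1)
    (hA : CentroidCostGE GA wA lA) (hB : CentroidCostGE GB wB lB) :
    CentroidCostGE (joinGraph GA GB a b) (joinWeight μ wA wB)
      (1 + (1 - μ) / 2 * (lA + lB)) := by
  intro V _ G φ w c hc hw hφ C hC
  set φA : GA ↪g G := (joinInl GA GB a b).trans φ with hφA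
  set φB : GB ↪g G := (joinInr GA GB a b).trans φ with hφB
  have hc' : 0 < c * ((1 - μ) / 2) := mul_pos hc (by linarith)
  have hwA : ∀ x, w (φA x) = c * ((1 - μ) / 2) * wA x := fun x => by
    rw [mul_assoc]
    exact hφ (some (.inl x))
  have hwB : ∀ x, w (φB x) = c * ((1 - μ) / 2) * wB x := fun x => by
    rw [mul_assoc]
    exact hφ (some (.inr x))
  have hrange : Set.range φ = insert (φ none) (Set.range φA ∪ Set.range φB) := by
    ext z
    constructor
    · rintro ⟨_ | x | x, rfl⟩
      exacts [Or.inl rfl, Or.inr (Or.inl ⟨x, rfl⟩), Or.inr (Or.inr ⟨x, rfl⟩)]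
    · rintro (rfl | ⟨x, rfl⟩ | ⟨x, rfl⟩)
      exacts [⟨_, rfl⟩, ⟨_, rfl⟩, ⟨_, rfl⟩]
  have hsA := wsum_range φA.injective hwA hA1
  have hsB := wsum_range φB.injective hwB hB1
  have hs : wsum w (Set.range φ) = c := by
    refine wsum_range φ.injective hφ ?_
    have := sum_joinWeight μ wA wB fun _ => 1
    simp only [mul_one, hA1, hB1] at this
    rw [this]
    ring
  rw [hrange] at hC hs
  obtain ⟨CA, CB, hCA, hCB, hcost⟩ := hC.exists_cost_eq hw (connIn_range φA hGA)
    (connIn_range φB hGB) (a := φA a) (b := φB b)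
    (by
      rw [Set.disjoint_left]
      rintro _ ⟨x, rfl⟩ ⟨y, hy⟩
      have : (some (.inr y) : Option (A ⊕ B)) = some (.inl x) := φ.injective hy
      simp at this)
    (by
      rintro ⟨x, hx⟩
      have : (some (.inl x) : Option (A ⊕ B)) = none := φ.injective hx
      simp at this)
    (by
      rintro ⟨x, hx⟩
      have : (some (.inr x) : Option (A ⊕ B)) = none := φ.injective hx
      simp at this)
    ⟨a, rfl⟩ ⟨b, rfl⟩
    (φ.map_adj_iff.2 (show (joinGraph GA GB a b).Adj none (some (.inl a)) from rfl))
    (φ.map_adj_iff.2 (show (joinGraph GA GB a b).Adj none (some (.inr b)) from rfl))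
    (by
      rintro _ ⟨x, rfl⟩ _ ⟨y, rfl⟩ hadj
      exact (φ.map_adj_iff (v := some (.inl x)) (w := some (.inr y))).1 hadj)
    (by
      rw [hφ]
      exact mul_pos hc hμ)
    (hsA.trans hsB.symm)
  have h1 := hA V G φA w _ hc' hw hwA CA hCA
  have h2 := hB V G φB w _ hc' hw hwB CB hCB
  rw [hcost, hs]
  linarith

end Join

section Gadget

/-- Raising all ranks by one, except for at most one vertex which gets rank one. -/
theorem IsRanking.of_shift {A : Type} {G : SimpleGraph A} {d d' : A → ℕ}
    (hd : IsRanking G Set.univ d) (s : Set A) (hs : s.Subsingleton) (h1 : ∀ x ∈ s, d' x = 1)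
    (h2 : ∀ x ∉ s, d' x = d x + 1) : IsRanking G Set.univ d' := by
  have hpos := fun x => hd.1 x trivial
  refine ⟨fun x _ => ?_, fun x y hxy he hr => ?_⟩
  · by_cases hx : x ∈ s
    · rw [h1 x hx]
    · rw [h2 x hx]
      omega
  have hx : x ∉ s := by
    intro hx
    have hy : y ∉ s := fun hy => hxy (hs hx hy)
    have := hpos y
    rw [h1 x hx, h2 y hy] at he
    omega
  have hy : y ∉ s := by
    intro hy
    have := hpos x
    rw [h1 y hy, h2 x hx] at he
    omega
  rw [h2 x hx, h2 y hy] at he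
  refine hd.2 x y hxy (by omega) (hr.mono fun z hz => ⟨trivial, ?_⟩)
  have hz2 : d' x ≤ d' z := hz.2
  have := hpos x
  by_cases hzs : z ∈ s
  · rw [h1 z hzs, h2 x hx] at hz2
    omega
  · rw [h2 z hzs, h2 x hx] at hz2
    omega

/-- A weighted tree of total weight one and maximum degree at most `Δ`, with a ranking `d` with
values at most `k + 1` and weighted rank sum at most `u`, such that `l` bounds the cost of its
centroid trees from below and `r` bounds the weighted rank sum of all rankings from below. -/
structure IsGadget {A : Type} [Fintype A] (Δ : ℕ) (G : SimpleGraph A) (w : A → ℝ) (d : A → ℕ)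
    (k : ℕ) (u l r : ℝ) : Prop where
  isTree : G.IsTree
  degree_le : ∀ x, (G.neighborSet x).ncard ≤ Δ
  nonneg : ∀ x, 0 ≤ w x
  sum_eq : ∑ x, w x = 1
  isRanking : IsRanking G Set.univ d
  rank_le : ∀ x, d x ≤ k + 1
  sum_le : ∑ x, w x * (d x : ℝ) ≤ u
  centroid : CentroidCostGE G w l
  le_sum : ∀ d', IsRanking G Set.univ d' → r ≤ ∑ x, w x * (d' x : ℝ)

theorem IsGadget.mono {A : Type} [Fintype A] {Δ : ℕ} {G : SimpleGraph A} {w : A → ℝ} {d : A → ℕ}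
    {k : ℕ} {u l r u' l' r' : ℝ} (h : IsGadget Δ G w d k u l r) (hu : u ≤ u') (hl : l' ≤ l)
    (hr : r' ≤ r) : IsGadget Δ G w d k u' l' r' :=
  { h with
    sum_le := h.sum_le.trans hu
    centroid := h.centroid.mono hl
    le_sum := fun d' hd' => hr.trans (h.le_sum d' hd') }

theorem IsGadget.shift {A : Type} [Fintype A] {Δ : ℕ} {G : SimpleGraph A} {w : A → ℝ}
    {d d' : A → ℕ} {k : ℕ} {u l r : ℝ} (h : IsGadget Δ G w d k u l r) (s : Set A)
    (hs : s.Subsingleton) (h1 : ∀ x ∈ s, d' x = 1) (h2 : ∀ x ∉ s, d' x = d x + 1) :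
    IsGadget Δ G w d' (k + 1) (u + 1) l r := by
  have hle : ∀ x, d' x ≤ d x + 1 := by
    intro x
    by_cases hx : x ∈ s
    · rw [h1 x hx]
      omega
    · exact (h2 x hx).le
  refine { h with
    isRanking := h.isRanking.of_shift s hs h1 h2
    rank_le := fun x => (hle x).trans (Nat.succ_le_succ (h.rank_le x))
    sum_le := ?_ }
  calc ∑ x, w x * (d' x : ℝ) ≤ ∑ x, (w x * (d x : ℝ) + w x) := by
        refine Finset.sum_le_sum fun x _ => ?_
        have : (d' x : ℝ) ≤ d x + 1 := mod_cast hle x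
        nlinarith [h.nonneg x]
    _ ≤ u + 1 := by
        rw [Finset.sum_add_distrib, h.sum_eq]
        linarith [h.sum_le]

theorem IsGadget.join {A B : Type} [Fintype A] [Fintype B] {Δ : ℕ} {GA : SimpleGraph A}
    {GB : SimpleGraph B} {wA : A → ℝ} {wB : B → ℝ} {dA : A → ℕ} {dB : B → ℕ} {k : ℕ}
    {uA lA rA uB lB rB μ : ℝ} {a : A} {b : B} (hΔ : 2 ≤ Δ) (hμ : 0 < μ) (hμ1 : μ < 1)
    (hA : IsGadget Δ GA wA dA k uA lA rA) (hB : IsGadget Δ GB wB dB k uB lB rB)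
    (ha : dA a = 1) (haΔ : (GA.neighborSet a).ncard < Δ) (hB2 : ∀ x, 2 ≤ dB x) (hb : dB b ≤ k)
    (hbΔ : (GB.neighborSet b).ncard < Δ) :
    IsGadget Δ (joinGraph GA GB a b) (joinWeight μ wA wB) (joinRank (k + 1) dA dB) k
      ((1 - μ) / 2 * (uA + uB) + μ * (k + 1)) (1 + (1 - μ) / 2 * (lA + lB))
      ((1 - μ) / 2 * (rA + rB + 1)) where
  isTree := joinGraph_isTree hA.isTree hB.isTree
  degree_le := joinGraph_ncard_neighborSet_le hΔ hA.degree_le hB.degree_le haΔ hbΔ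
  nonneg := by
    have h : 0 ≤ (1 - μ) / 2 := by linarith
    rintro (_ | x | x)
    exacts [hμ.le, mul_nonneg h (hA.nonneg x), mul_nonneg h (hB.nonneg x)]
  sum_eq := by
    have := sum_joinWeight μ wA wB fun _ => 1
    simp only [mul_one, hA.sum_eq, hB.sum_eq] at this
    rw [this]
    ring
  isRanking := isRanking_joinRank hA.isTree.connected hA.isRanking hB.isRanking ha hA.rank_le
    hB.rank_le hB2 hb
  rank_le := by
    rintro (_ | x | x)
    exacts [le_rfl, hA.rank_le x, hB.rank_le x]
  sum_le := by
    rw [sum_joinWeight μ wA wB fun z => (joinRank (k + 1) dA dB z : ℝ)]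
    simp only [joinRank]
    have := mul_le_mul_of_nonneg_left (add_le_add hA.sum_le hB.sum_le)
      (show 0 ≤ (1 - μ) / 2 by linarith)
    push_cast
    linarith
  centroid := hA.centroid.join hA.isTree.connected hB.isTree.connected hμ hμ1 hA.sum_eq hB.sum_eq
    hB.centroid
  le_sum := fun d' hd' => le_sum_joinWeight_mul hA.isTree.connected hB.isTree.connected hμ.le
    hμ1.le hA.sum_eq hB.sum_eq hA.le_sum hB.le_sum hd'

/-- A gadget with two leaves of non-maximal rank. -/
def HasPathGadget (Δ k : ℕ) (u l r : ℝ) : Prop :=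
  ∃ (A : Type) (_ : Fintype A) (G : SimpleGraph A) (w : A → ℝ) (d : A → ℕ) (p q : A),
    IsGadget Δ G w d k u l r ∧ p ≠ q ∧ (G.neighborSet p).ncard ≤ 1 ∧
      (G.neighborSet q).ncard ≤ 1 ∧ d p ≤ k ∧ d q ≤ k

/-- A gadget with a vertex `c` of rank one to which `j` further gadgets have been attached, and
leaves `q`, `q'` of non-maximal rank, distinct if `j` is positive. -/
def HasStarGadget (Δ k j : ℕ) (u l r : ℝ) : Prop :=
  ∃ (A : Type) (_ : Fintype A) (G : SimpleGraph A) (w : A → ℝ) (d : A → ℕ) (c q q' : A),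
    IsGadget Δ G w d k u l r ∧ d c = 1 ∧ (G.neighborSet c).ncard ≤ 1 + j ∧ q ≠ c ∧
      (G.neighborSet q).ncard ≤ 1 ∧ (G.neighborSet q').ncard ≤ 1 ∧ d q ≤ k ∧ d q' ≤ k ∧
        (1 ≤ j → q ≠ q')

theorem HasPathGadget.hasStarGadget {Δ k : ℕ} {u l r : ℝ} (h : HasPathGadget Δ k u l r) :
    HasStarGadget Δ (k + 1) 0 (u + 1) l r := by
  classical
  obtain ⟨A, _, G, w, d, p, q, hG, hpq, hp, hq, hdp, hdq⟩ := h
  refine ⟨A, _, G, w, Function.update (fun x => d x + 1) p 1, p, q, q,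
    hG.shift {p} Set.subsingleton_singleton ?_ ?_, ?_, hp, hpq.symm, hq, hq, ?_, ?_, by simp⟩
  · rintro _ rfl
    simp
  · rintro x hx
    rw [Function.update_of_ne hx]
  · simp
  all_goals
    rw [Function.update_of_ne hpq.symm]
    omega

theorem HasStarGadget.join {Δ k j : ℕ} {uA lA rA u l r μ : ℝ} (hΔ : j + 2 ≤ Δ)
    (hμ : 0 < μ) (hμ1 : μ < 1)
    (h : HasStarGadget Δ (k + 1) j uA lA rA) (h' : HasPathGadget Δ k u l r) :
    HasStarGadget Δ (k + 1) (j + 1) ((1 - μ) / 2 * (uA + (u + 1)) + μ * (k + 2))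
      (1 + (1 - μ) / 2 * (lA + l)) ((1 - μ) / 2 * (rA + r + 1)) := by
  obtain ⟨A, _, GA, wA, dA, c, q, q', hA, hdc, hc, hqc, hq, -, hdq, -, -⟩ := h
  obtain ⟨B, _, GB, wB, dB, p, t, hB, hpt, hp, ht, hdp, hdt⟩ := h'
  have hB' := hB.shift (d' := fun x => dB x + 1) ∅ Set.subsingleton_empty (by simp) (by simp)
  have hJ := hA.join (a := c) (b := p) (by omega) hμ hμ1 hB' hdc (by omega)
    (fun x => Nat.succ_le_succ (hB.isRanking.1 x trivial)) (Nat.succ_le_succ hdp) (by omega)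
  refine ⟨Option (A ⊕ B), inferInstance, joinGraph GA GB c p, joinWeight μ wA wB,
    joinRank (k + 2) dA fun x => dB x + 1, some (.inl c), some (.inl q), some (.inr t),
    hJ.mono ?_ le_rfl le_rfl, hdc, ?_, ?_, (ncard_neighborSet_inl_of_ne hqc).trans hq,
    (ncard_neighborSet_inr_of_ne hpt.symm).trans ht, hdq, Nat.succ_le_succ hdt, by simp⟩
  · push_cast
    linarith
  · have := ncard_neighborSet_inl_le (GA := GA) (GB := GB) (a := c) (b := p) c
    omega
  · simpa using hqc

theorem HasStarGadget.hasPathGadget {Δ k j : ℕ} {u l r : ℝ} (hj : 1 ≤ j)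
    (h : HasStarGadget Δ k j u l r) : HasPathGadget Δ k u l r := by
  obtain ⟨A, _, G, w, d, c, q, q', hG, -, -, -, hq, hq', hdq, hdq', hne⟩ := h
  exact ⟨A, _, G, w, d, q, q', hG, hne hj, hq, hq', hdq, hdq'⟩

theorem HasPathGadget.mono {Δ k : ℕ} {u l r u' l' r' : ℝ} (h : HasPathGadget Δ k u l r)
    (hu : u ≤ u') (hl : l' ≤ l) (hr : r' ≤ r) : HasPathGadget Δ k u' l' r' := by
  obtain ⟨A, _, G, w, d, p, q, hG, h⟩ := h
  exact ⟨A, _, G, w, d, p, q, hG.mono hu hl hr, h⟩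

theorem HasStarGadget.mono {Δ k j : ℕ} {u l r u' l' r' : ℝ} (h : HasStarGadget Δ k j u l r)
    (hu : u ≤ u') (hl : l' ≤ l) (hr : r' ≤ r) : HasStarGadget Δ k j u' l' r' := by
  obtain ⟨A, _, G, w, d, c, q, q', hG, h⟩ := h
  exact ⟨A, _, G, w, d, c, q, q', hG.mono hu hl hr, h⟩

theorem centroidCostGE_one {A : Type} [Fintype A] {H : SimpleGraph A} {ω : A → ℝ}
    (h1 : ∑ x, ω x = 1) : CentroidCostGE H ω 1 := by
  intro V _ G φ w c _ hw hφ C hC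
  rw [mul_one, hC.1.cost_eq, ← wsum_range φ.injective hφ h1, wsum_eq_sum, wsum_eq_sum]
  refine Finset.sum_le_sum fun x hx => le_mul_of_one_le_right (hw x) ?_
  exact_mod_cast hC.1.isRanking_depth.1 x ((Set.Finite.mem_toFinset _).1 hx)

theorem isTree_top_bool : (⊤ : SimpleGraph Bool).IsTree := by
  have hc : (⊤ : SimpleGraph Bool).Connected := SimpleGraph.connected_top
  refine SimpleGraph.isTree_iff_connected_and_card.2 ⟨hc, le_antisymm ?_ ?_⟩
  · have hsub : (⊤ : SimpleGraph Bool).edgeSet ⊆ {s(false, true)} := by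
      intro e
      induction e with
      | _ x y => cases x <;> cases y <;> simp
    have := (Set.ncard_le_ncard hsub).trans (Set.ncard_singleton _).le
    rw [Nat.card_coe_set_eq, Nat.card_eq_fintype_card, Fintype.card_bool]
    omega
  · exact hc.card_vert_le_card_edgeSet_add_one

theorem hasPathGadget_zero {Δ : ℕ} (hΔ : 1 ≤ Δ) : HasPathGadget Δ 2 1 1 0 := by
  have hdeg : ∀ x, ((⊤ : SimpleGraph Bool).neighborSet x).ncard ≤ 1 := by
    intro x
    refine (Set.ncard_le_ncard (t := {!x}) fun y hy => ?_).trans (Set.ncard_singleton _).le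
    cases x <;> cases y <;> simp_all
  refine ⟨Bool, inferInstance, ⊤, fun b => if b then 0 else 1, fun b => if b then 2 else 1,
    false, true, ?_, by simp, hdeg _, hdeg _, by simp, by simp⟩
  exact
    { isTree := isTree_top_bool
      degree_le := fun x => (hdeg x).trans hΔ
      nonneg := by simp
      sum_eq := by simp
      isRanking := ⟨by simp, by simp⟩
      rank_le := by simp
      sum_le := by simp
      centroid := centroidCostGE_one (by simp)
      le_sum := by simp }

theorem hasStarGadget_of_hasPathGadget {Δ n : ℕ} {h : ℝ} (h0 : 0 ≤ h) (h2 : h ≤ 2)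
    (hn : ∀ ε > 0, HasPathGadget Δ (n + 2) (n + 1 + ε) (1 + n * h - ε) (n / 2 - ε)) (j : ℕ)
    (hj : j + 1 ≤ Δ) : ∀ ε > 0, HasStarGadget Δ (n + 3) j (n + 2 + ε)
      (1 + n * h + (2 - 2 / 2 ^ j) - ε) (n / 2 + (if j = 0 then 0 else 1 / 2) - ε) := by
  induction j with
  | zero =>
    intro ε hε
    exact (hn ε hε).hasStarGadget.mono (by linarith) (by norm_num) (by simp)
  | succ j ih =>
    intro ε hε
    have hε2 : 0 < ε / 2 := by linarith
    have hn0 : (0 : ℝ) ≤ n := n.cast_nonneg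
    obtain ⟨μ, hμ, hμ1, hμε⟩ : ∃ μ : ℝ, 0 < μ ∧ μ < 1 ∧ μ * (2 * n + 6) ≤ ε / 2 := by
      refine ⟨ε / (ε + 2 * (2 * n + 6)), by positivity, ?_, ?_⟩
      · rw [div_lt_one (by positivity)]
        linarith
      · rw [div_mul_eq_mul_div, div_le_iff₀ (by positivity)]
        nlinarith
    have hpow : (0 : ℝ) < 1 / 2 ^ j := by positivity
    have hs : (2 : ℝ) / 2 ^ (j + 1) = 1 / 2 ^ j := by
      rw [pow_succ]
      field_simp
    have hs' : (2 : ℝ) / 2 ^ j = 2 * (1 / 2 ^ j) := by ring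
    have hif : (0 : ℝ) ≤ (if j = 0 then 0 else 1 / 2) ∧
        (if j = 0 then 0 else 1 / 2 : ℝ) ≤ 1 / 2 := by
      split_ifs <;> norm_num
    have hnh : n * h ≤ n * 2 := mul_le_mul_of_nonneg_left h2 hn0
    have hnh0 : 0 ≤ n * h := mul_nonneg hn0 h0
    rw [hs, if_neg j.succ_ne_zero]
    refine ((ih (by omega) _ hε2).join (by omega) hμ hμ1 (hn _ hε2)).mono ?_ ?_ ?_
    · push_cast
      nlinarith
    · rw [hs']
      nlinarith
    · nlinarith [hif.1, hif.2]

theorem hasPathGadget {Δ : ℕ} (hΔ : 2 ≤ Δ) (n : ℕ) : ∀ ε > 0,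
    HasPathGadget Δ (n + 2) (n + 1 + ε) (1 + n * (2 - 4 / 2 ^ Δ) - ε) (n / 2 - ε) := by
  have hpow : (4 : ℝ) ≤ 2 ^ Δ := by
    calc (4 : ℝ) = 2 ^ 2 := by norm_num
      _ ≤ 2 ^ Δ := pow_le_pow_right₀ one_le_two hΔ
  have h1 : (4 : ℝ) / 2 ^ Δ ≤ 1 := (div_le_one (by positivity)).2 hpow
  have h0 : (0 : ℝ) < 4 / 2 ^ Δ := by positivity
  induction n with
  | zero =>
    intro ε hε
    refine (hasPathGadget_zero (by omega)).mono ?_ ?_ ?_ <;> norm_num <;> exact hε.le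
  | succ n ih =>
    intro ε hε
    refine ((hasStarGadget_of_hasPathGadget (by linarith) (by linarith) ih (Δ - 1) (by omega) ε
      hε).hasPathGadget (by omega)).mono ?_ ?_ ?_
    · push_cast
      linarith
    · obtain ⟨m, rfl⟩ : ∃ m, Δ = m + 1 := ⟨Δ - 1, by omega⟩
      have : (4 : ℝ) / 2 ^ (m + 1) = 2 / 2 ^ m := by
        rw [pow_succ]
        field_simp
        norm_num
      rw [this, Nat.add_sub_cancel]
      push_cast
      linarith
    · rw [if_neg (by omega)]
      push_cast
      linarith

end Gadget


theorem lower_bound_bounded_degree_asymptotic (Δ : ℕ) (hΔ : 3 ≤ Δ) :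
    ∃ (V : ℕ → Type) (_ : ∀ n, Fintype (V n)) (G : ∀ n, SimpleGraph (V n))
      (w : ∀ n, V n → ℝ),
      (∀ n, (G n).IsTree) ∧
      (∀ n, ∀ v : V n, ((G n).neighborSet v).ncard ≤ Δ) ∧
      (∀ n x, 0 ≤ w n x) ∧
      (∀ n, wsum (w n) Set.univ = 1) ∧
      Filter.Tendsto (fun n => OPT (G n) (w n) Set.univ) Filter.atTop Filter.atTop ∧
      (∀ n, ∀ C : RTree (V n), IsCentroidTree (G n) (w n) Set.univ C →
        cost (w n) C ≥ (2 - 4 / 2 ^ Δ) * OPT (G n) (w n) Set.univ - 1) := by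
  set ε : ℝ := 4 / 2 ^ Δ / 3 with hε_def
  have hε : 0 < ε := by positivity
  have h3 : (4 : ℝ) / 2 ^ Δ = 3 * ε := by
    rw [hε_def]
    ring
  choose A hA G w d p q hG _ using fun n => hasPathGadget (by omega : 2 ≤ Δ) n ε hε
  have hconn := fun n => (hG n).isTree.connected
  refine ⟨A, hA, G, w, fun n => (hG n).isTree, fun n => (hG n).degree_le, fun n => (hG n).nonneg,
    fun n => (wsum_univ _).trans (hG n).sum_eq, ?_, fun n C hC => ?_⟩
  · refine Filter.tendsto_atTop_mono
      (fun n => le_OPT_of_isRanking (hconn n) (hG n).isRanking (hG n).le_sum) ?_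
    exact Filter.tendsto_atTop_add_const_right _ _
      (tendsto_natCast_atTop_atTop.atTop_div_const two_pos)
  · have hopt := (OPT_le_of_isRanking (hconn n) (hG n).nonneg (hG n).isRanking).trans (hG n).sum_le
    have hcent := (hG n).centroid (A n) (G n) (SimpleGraph.Embedding.refl) (w n) 1 one_pos
      (hG n).nonneg (fun x => (one_mul _).symm) C
      (by rwa [show Set.range (SimpleGraph.Embedding.refl : G n ↪g G n) = Set.univ from
        Set.range_id])
    have hpow : (4 : ℝ) ≤ 2 ^ Δ := by
      calc (4 : ℝ) = 2 ^ 2 := by norm_num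
        _ ≤ 2 ^ Δ := pow_le_pow_right₀ one_le_two (by omega)
    have h1 : (4 : ℝ) / 2 ^ Δ ≤ 1 := (div_le_one (by positivity)).2 hpow
    rw [h3] at h1 hcent ⊢
    have := mul_le_mul_of_nonneg_left hopt (show 0 ≤ 2 - 3 * ε by linarith)
    nlinarith
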